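/- arXiv:math/0010108 — 2 statements merged into one kernel-verified Lean document; each statement's English description precedes it below -/
import Mathlib

section
/- For every partition μ = (μ₁ ≥ … ≥ μ_n ≥ 0), there is a bijection Y ↦ R(Y) between the set of semistandard Young tableaux of shape μ with entries in {1,…,n} and the set of rc-graphs R with w_R = w(μ); moreover this bijection is weight-preserving: x^{R(Y)} = x^Y for every such tableau Y. -/
open scoped Classical

noncomputable section

namespace RCGraphs

/-- The simple transposition `s j`, interchanging `j` and `j+1`. -/
def sT (j : ℤ) : Equiv.Perm ℤ := Equiv.swap j (j + 1)

/-- The Coxeter length of a permutation of `ℤ`: the minimal length of an expression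
as a product of simple transpositions. -/
def len (w : Equiv.Perm ℤ) : ℕ :=
  sInf {m : ℕ | ∃ l : List ℤ, l.length = m ∧ (l.map sT).prod = w}

/-- The permutations considered in the paper: bijections of `ℤ` fixing every `i > n`
and fixing all sufficiently small integers. -/
def IsPermZ (n : ℤ) (w : Equiv.Perm ℤ) : Prop :=
  (∀ i : ℤ, n < i → w i = i) ∧ ∃ N : ℤ, ∀ i : ℤ, i < N → w i = i

/-- The reading order on positions `(i,k)`: rows (second coordinate) from `n` downward,
and within a row in order of increasing first coordinate. -/
def rcOrder (p q : ℤ × ℤ) : Prop :=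
  q.2 < p.2 ∨ (p.2 = q.2 ∧ p.1 ≤ q.1)

instance : DecidableRel rcOrder := fun p q => by
  unfold rcOrder; infer_instance

instance : IsTrans (ℤ × ℤ) rcOrder :=
  ⟨fun a b c h₁ h₂ => by unfold rcOrder at *; omega⟩

instance : IsAntisymm (ℤ × ℤ) rcOrder :=
  ⟨fun a b h₁ h₂ => by
    unfold rcOrder at *
    have h3 : a.1 = b.1 ∧ a.2 = b.2 := by omega
    exact Prod.ext h3.1 h3.2⟩

instance : IsTotal (ℤ × ℤ) rcOrder :=
  ⟨fun a b => by unfold rcOrder; omega⟩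

/-- The permutation `w_R` associated to a finite set of positions `R`: the product of the
simple transpositions `s_{i+k-n-1}`, `(i,k) ∈ R`, in the reading order. -/
def wR (n : ℤ) (R : Finset (ℤ × ℤ)) : Equiv.Perm ℤ :=
  ((R.sort rcOrder).map fun p => sT (p.1 + p.2 - n - 1)).prod

/-- `R` is an rc-graph: positions lie in the grid `{(i,k) : i ≤ n, k ≤ n}` and the
reading word is reduced. -/
def IsRC (n : ℤ) (R : Finset (ℤ × ℤ)) : Prop :=
  (∀ p ∈ R, p.1 ≤ n ∧ p.2 ≤ n) ∧ len (wR n R) = R.card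

/-- Condition (*): `w_R(i) > w_R(i-1)` for all `i ≤ 0`; equivalently no two strands with
nonpositive labels cross. -/
def Star (n : ℤ) (R : Finset (ℤ × ℤ)) : Prop :=
  ∀ i : ℤ, i ≤ 0 → wR n R (i - 1) < wR n R i

/-- Strand labels in the wiring diagram of `R` (for diagrams all of whose crossings lie in
rows `k ≥ 1`, as is the case under condition (*)).  `lab n R true i k` is the label of the
strand entering position `(i,k)` from the west (the strand passing above, if `(i,k)` is not
a crossing); `lab n R false i k` is the label of the strand entering from the south (the
strand passing below).  Each strand is labeled by the row where it begins. -/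
def lab (n : ℤ) (R : Finset (ℤ × ℤ)) : Bool → ℤ → ℤ → ℤ
  | true, i, k =>
      if h : n ≤ i then k
      else if (i + 1, k) ∈ R then lab n R true (i + 1) k else lab n R false (i + 1) k
  | false, i, k =>
      if h : k ≤ 0 then i + k - n - 1
      else if (i, k - 1) ∈ R then lab n R false i (k - 1) else lab n R true i (k - 1)
  termination_by b i k => ((n - i).toNat + k.toNat)
  decreasing_by
    all_goals simp_wf
    all_goals omega

/-- The label of the strand leaving position `(i,r)` northward. -/
def northLabel (n : ℤ) (R : Finset (ℤ × ℤ)) (i r : ℤ) : ℤ :=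
  if (i, r) ∈ R then lab n R false i r else lab n R true i r

/-- `(i,k)` is an open space: not a crossing, the strand passing below it has a
nonpositive label and the strand passing above it has a positive label. -/
def OpenSpace (n : ℤ) (R : Finset (ℤ × ℤ)) (i k : ℤ) : Prop :=
  i ≤ n ∧ (i, k) ∉ R ∧ lab n R false i k ≤ 0 ∧ 0 < lab n R true i k

/-- The main loop of the Bergeron--Billey insertion algorithm, recording the trace:
the list of pairs (current diagram, crossing just added).  `R` always contains the
crossing `p` that was just added. -/
def insertSteps (n : ℤ) : ℕ → Finset (ℤ × ℤ) → ℤ × ℤ → List (Finset (ℤ × ℤ) × (ℤ × ℤ))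
  | 0, _, _ => []
  | fuel + 1, R, p =>
      (R, p) ::
        if IsRC n R then []
        else
          let a := lab n R true p.1 p.2
          let b := lab n R false p.1 p.2
          -- the unique other crossing of the two strands that cross at `p`
          let C := R.filter fun q =>
            q ≠ p ∧ ((lab n R true q.1 q.2 = a ∧ lab n R false q.1 q.2 = b) ∨
                     (lab n R true q.1 q.2 = b ∧ lab n R false q.1 q.2 = a))
          let q := (C.sort rcOrder).headI
          let R' := R.erase q
          let i' := sInf {x : ℤ | q.1 < x ∧ OpenSpace n R' x q.2}
          insertSteps n fuel (insert (i', q.2) R') (i', q.2)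

/-- The trace of the insertion of `k` into `R`: the states of the algorithm together with
the crossings added at each step. -/
def insertStepsOf (n : ℤ) (R : Finset (ℤ × ℤ)) (k : ℤ) : List (Finset (ℤ × ℤ) × (ℤ × ℤ)) :=
  let i₁ := sInf {x : ℤ | OpenSpace n R x k}
  insertSteps n ((n + 1 - k).toNat + 1) (insert (i₁, k) R) (i₁, k)

/-- The insertion `R ← k` of Bergeron and Billey. -/
def insertOne (n : ℤ) (R : Finset (ℤ × ℤ)) (k : ℤ) : Finset (ℤ × ℤ) :=
  ((insertStepsOf n R k).getLast?.getD (R, (0, 0))).1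

/-- The insertion `R ← v` of a word. -/
def insertWord (n : ℤ) (R : Finset (ℤ × ℤ)) (v : List ℕ) : Finset (ℤ × ℤ) :=
  v.foldl (fun S a => insertOne n S (a : ℤ)) R

/-- The column (first coordinate) at which the strand labeled `a` of the diagram `R`
leaves row `r` northward. -/
def strandCol (n : ℤ) (R : Finset (ℤ × ℤ)) (a r : ℤ) : ℤ :=
  sSup {i : ℤ | i ≤ n ∧ northLabel n R i r = a}

/-- Given the trace `L` of an insertion, the column occupied in row `r` by the left path
(`left = true`) or the right path (`left = false`) of the insertion.  Between the rows of
the `t`-th and `(t+1)`-st added crossings, the left path is the piece `s_t` of the strand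
whose label changes from `a_t` to `b_t`, and the right path is the piece `s^t` whose label
changes from `b_t` to `a_t`. -/
def pathCol (n : ℤ) (L : List (Finset (ℤ × ℤ) × (ℤ × ℤ))) (left : Bool) (r : ℤ) : ℤ :=
  match (L.filter fun e => e.2.2 ≤ r).getLast? with
  | some e => strandCol n e.1 (lab n e.1 left e.2.1 e.2.2) r
  | none => 0

/-- A semistandard Young tableau with at most `n` rows (rows indexed `1,…,n`, row `j`
having `μ j` boxes, columns indexed from `0`), with entries in `{1,…,n}`, weakly
increasing along rows and strictly increasing down columns; entries outside the shape
are `0`. -/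
structure SSYT (n : ℕ) (μ : ℕ → ℕ) where
  entry : ℕ → ℕ → ℕ
  entry_mem : ∀ j c, 1 ≤ j → j ≤ n → c < μ j → 1 ≤ entry j c ∧ entry j c ≤ n
  row_weak : ∀ j c₁ c₂, 1 ≤ j → j ≤ n → c₁ ≤ c₂ → c₂ < μ j → entry j c₁ ≤ entry j c₂
  col_strict : ∀ j₁ j₂ c, 1 ≤ j₁ → j₁ < j₂ → j₂ ≤ n → c < μ j₂ → entry j₁ c < entry j₂ c
  outside : ∀ j c, j = 0 ∨ n < j ∨ μ j ≤ c → entry j c = 0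

/-- `μ` is a partition with (at most) `n` parts `μ 1 ≥ μ 2 ≥ … ≥ μ n ≥ 0`
(and `μ j = 0` outside `1,…,n`). -/
def IsPartition (n : ℕ) (μ : ℕ → ℕ) : Prop :=
  (∀ j, 1 ≤ j → j < n → μ (j + 1) ≤ μ j) ∧ ∀ j, j = 0 ∨ n < j → μ j = 0

/-- The reading word of a tableau: the rows read left to right, from the bottom row
to the top one. -/
def readingWord (n : ℕ) (μ : ℕ → ℕ) (Y : SSYT n μ) : List ℕ :=
  ((List.range n).reverse.map (· + 1)).flatMap fun j =>
    (List.range (μ j)).map fun c => Y.entry j c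

/-- An elementary Knuth move. -/
def KnuthMove (w₁ w₂ : List ℕ) : Prop :=
  (∃ (u v : List ℕ) (x y z : ℕ), x < y ∧ y ≤ z ∧
      w₁ = u ++ y :: x :: z :: v ∧ w₂ = u ++ y :: z :: x :: v) ∨
  (∃ (u v : List ℕ) (x y z : ℕ), x ≤ y ∧ y < z ∧
      w₁ = u ++ x :: z :: y :: v ∧ w₂ = u ++ z :: x :: y :: v)

/-- Knuth equivalence: the equivalence relation generated by elementary Knuth moves. -/
def KnuthEquiv (w₁ w₂ : List ℕ) : Prop := Relation.EqvGen KnuthMove w₁ w₂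

/-- The monomial `x^R = ∏_{(i,k) ∈ R} x_k`. -/
def xR (R : Finset (ℤ × ℤ)) : MvPolynomial ℕ ℤ :=
  ∏ p ∈ R, MvPolynomial.X p.2.toNat

/-- The monomial `x^Y = ∏ x_i`, one factor for each entry `i` of `Y`. -/
def xY (n : ℕ) (μ : ℕ → ℕ) (Y : SSYT n μ) : MvPolynomial ℕ ℤ :=
  ((readingWord n μ Y).map MvPolynomial.X).prod

/-- The Schubert polynomial `S_w = Σ_{R : w_R = w} x^R`. -/
def Schub (n : ℤ) (w : Equiv.Perm ℤ) : MvPolynomial ℕ ℤ :=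
  ∑ᶠ R ∈ {R : Finset (ℤ × ℤ) | IsRC n R ∧ wR n R = w}, xR R

/-- The Schur polynomial `s_μ(x₁,…,x_n) = Σ_Y x^Y`, summing over all semistandard Young
tableaux of shape `μ` with entries in `{1,…,n}`. -/
def SchurP (n : ℕ) (μ : ℕ → ℕ) : MvPolynomial ℕ ℤ :=
  ∑ᶠ Y : SSYT n μ, xY n μ Y

/-- The complete homogeneous symmetric polynomial
`h_m = Σ_{1 ≤ i₁ ≤ … ≤ i_m ≤ n} x_{i₁} ⋯ x_{i_m}`. -/
def hPoly (n m : ℕ) : MvPolynomial ℕ ℤ :=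
  ∑ s ∈ (Finset.Icc 1 n).sym m, (s.1.map MvPolynomial.X).prod

/-- The top rc-graph `R(μ) = {(i,k) : 1 ≤ k ≤ n, n - μ_k + 1 ≤ i ≤ n}` of a partition. -/
def Rmu (n : ℕ) (μ : ℕ → ℕ) : Finset (ℤ × ℤ) :=
  (Finset.Icc 1 (n : ℤ)).biUnion fun k =>
    (Finset.Icc ((n : ℤ) - μ k.toNat + 1) (n : ℤ)).image fun i => (i, k)


/-! ### Auxiliary material -/

lemma part_anti {n : ℕ} {μ : ℕ → ℕ} (hμ : IsPartition n μ) {a b : ℕ} (ha : 1 ≤ a) (hab : a ≤ b) :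
    μ b ≤ μ a := by
  induction b, hab using Nat.le_induction with
  | base => exact le_rfl
  | succ b hb ih =>
    rcases lt_or_ge b n with h | h
    · exact (hμ.1 b (by omega) h).trans ih
    · rw [hμ.2 (b + 1) (by omega)]; exact Nat.zero_le _

/-- `w` is the Grassmannian permutation of shape `μ`. -/
def Gr (w : Equiv.Perm ℤ) (μ : ℕ → ℕ) : Prop :=
  (∀ k : ℕ, 1 ≤ k → w (k : ℤ) = (k : ℤ) - μ k) ∧ ∀ a b : ℤ, a < b → b ≤ 0 → w a < w b

lemma sT_apply (j x : ℤ) : sT j x = if x = j then j + 1 else if x = j + 1 then j else x := by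
  unfold sT; exact Equiv.swap_apply_def _ _ _

lemma Gr_one : Gr 1 (fun _ => 0) := by
  constructor
  · intro k _; simp
  · intro a b h _; simpa using h

lemma Gr_step {w : Equiv.Perm ℤ} {μ : ℕ → ℕ} (h : Gr w μ) {k : ℕ} (hk : 1 ≤ k)
    (hfree : ∀ k' : ℕ, 1 ≤ k' → w (k' : ℤ) ≠ (k : ℤ) - μ k - 1) :
    Gr (sT ((k : ℤ) - μ k - 1) * w) (Function.update μ k (μ k + 1)) := by
  constructor
  · intro k' hk'
    rw [Equiv.Perm.mul_apply, sT_apply, if_neg (hfree k' hk')]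
    by_cases hkk : k' = k
    · subst hkk
      rw [if_pos (by rw [h.1 k' hk']; ring), Function.update_self]
      push_cast; ring
    · rw [Function.update_of_ne hkk, if_neg, h.1 k' hk']
      intro h2
      have h3 : w (k' : ℤ) = w (k : ℤ) := by rw [h2, h.1 k hk]; ring
      exact hkk (by exact_mod_cast w.injective h3)
  · intro a b hab hb
    have h1 := h.2 a b hab hb
    have key : ∀ x : ℤ, x ≤ 0 → w x ≠ (k : ℤ) - μ k := by
      intro x hx h2
      rw [← h.1 k hk] at h2
      have := w.injective h2
      omega
    have ha' := key a (by omega)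
    have hb' := key b hb
    rw [Equiv.Perm.mul_apply, Equiv.Perm.mul_apply, sT_apply, sT_apply]
    split_ifs <;> omega

lemma Gr_unique {w w' : Equiv.Perm ℤ} {μ : ℕ → ℕ} (h : Gr w μ) (h' : Gr w' μ) : w = w' := by
  have pos : ∀ x : ℤ, 1 ≤ x → w x = w' x := by
    intro x hx
    obtain ⟨k, rfl⟩ := Int.eq_ofNat_of_zero_le (show 0 ≤ x by omega)
    rw [h.1 k (by omega), h'.1 k (by omega)]
  have main : ∀ (u v : Equiv.Perm ℤ), (∀ x : ℤ, 1 ≤ x → u x = v x) →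
      (∀ a b : ℤ, a < b → b ≤ 0 → u a < u b) → (∀ a b : ℤ, a < b → b ≤ 0 → v a < v b) →
      ∀ m : ℕ, v.symm (u (-(m : ℤ))) ≤ -(m : ℤ) := by
    intro u v huv hu hv
    have hle : ∀ x : ℤ, x ≤ 0 → v.symm (u x) ≤ 0 := by
      intro x hx
      by_contra hc
      have h2 := huv (v.symm (u x)) (by omega)
      rw [Equiv.apply_symm_apply] at h2
      have := u.injective h2
      omega
    intro m
    induction m with
    | zero => simpa using hle 0 le_rfl
    | succ m ih =>
      have h1 := hu (-((m + 1 : ℕ) : ℤ)) (-(m : ℤ)) (by push_cast; omega) (by omega)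
      have h2 : v.symm (u (-((m + 1 : ℕ) : ℤ))) < v.symm (u (-(m : ℤ))) := by
        by_contra hc
        rcases (not_lt.1 hc).lt_or_eq with h3 | h3
        · have := hv _ _ h3 (hle _ (by omega))
          simp only [Equiv.apply_symm_apply] at this
          omega
        · have := v.symm.injective h3
          omega
      push_cast at h2 ih ⊢
      omega
  have m1 := main w w' pos h.2 h'.2
  have m2 := main w' w (fun x hx => (pos x hx).symm) h'.2 h.2
  ext x
  rcases lt_or_ge 0 x with hx | hx
  · exact pos x hx
  · obtain ⟨m, hm⟩ := Int.eq_ofNat_of_zero_le (show 0 ≤ -x by omega)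
    obtain rfl : x = -(m : ℤ) := by omega
    have a1 := m1 m
    have a2 := m2 m
    apply le_antisymm
    · by_contra hc
      rcases a1.lt_or_eq with h3 | h3
      · have := h'.2 _ _ h3 hx
        rw [Equiv.apply_symm_apply] at this
        omega
      · rw [Equiv.symm_apply_eq] at h3
        omega
    · by_contra hc
      rcases a2.lt_or_eq with h3 | h3
      · have := h.2 _ _ h3 hx
        rw [Equiv.apply_symm_apply] at this
        omega
      · rw [Equiv.symm_apply_eq] at h3
        omega

/-- Energy of a permutation. -/
def en (n : ℕ) (w : Equiv.Perm ℤ) : ℤ := ∑ k ∈ Finset.Icc 1 n, ((k : ℤ) - w (k : ℤ))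

lemma en_step (n : ℕ) (w : Equiv.Perm ℤ) (j : ℤ) :
    en n (sT j * w) = en n w + ((Finset.Icc 1 n).filter fun k : ℕ => w (k : ℤ) = j + 1).card
      - ((Finset.Icc 1 n).filter fun k : ℕ => w (k : ℤ) = j).card := by
  unfold en
  rw [Finset.card_filter, Finset.card_filter]
  push_cast
  rw [← Finset.sum_add_distrib, ← Finset.sum_sub_distrib]
  apply Finset.sum_congr rfl
  intro k _
  rw [Function.comp_apply, sT_apply]
  split_ifs <;> omega

lemma card_le_one_aux (n : ℕ) (w : Equiv.Perm ℤ) (j : ℤ) :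
    ((Finset.Icc 1 n).filter fun k : ℕ => w (k : ℤ) = j).card ≤ 1 := by
  rw [Finset.card_le_one]
  intro a ha b hb
  rw [Finset.mem_filter] at ha hb
  have := w.injective (ha.2.trans hb.2.symm)
  exact_mod_cast this

lemma en_le (n : ℕ) (l : List ℤ) : en n (l.map sT).prod ≤ l.length := by
  induction l with
  | nil => simp [en]
  | cons a t ih =>
    rw [List.map_cons, List.prod_cons, en_step, List.length_cons]
    have := card_le_one_aux n (t.map sT).prod (a + 1)
    push_cast
    omega

lemma en_eq {n : ℕ} {w : Equiv.Perm ℤ} {j : ℤ} (h : en n w + 1 ≤ en n (sT j * w)) :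
    (∃ k : ℕ, 1 ≤ k ∧ k ≤ n ∧ w (k : ℤ) = j + 1) ∧
      ∀ k : ℕ, 1 ≤ k → k ≤ n → w (k : ℤ) ≠ j := by
  rw [en_step] at h
  have h1 := card_le_one_aux n w (j + 1)
  have h2 : 0 < ((Finset.Icc 1 n).filter fun k : ℕ => w (k : ℤ) = j + 1).card := by omega
  have h3 : ((Finset.Icc 1 n).filter fun k : ℕ => w (k : ℤ) = j).card = 0 := by omega
  constructor
  · obtain ⟨k, hk⟩ := Finset.card_pos.1 h2
    simp only [Finset.mem_filter, Finset.mem_Icc] at hk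
    exact ⟨k, hk.1.1, hk.1.2, hk.2⟩
  · intro k hk1 hk2 hk3
    rw [Finset.card_eq_zero, Finset.filter_eq_empty_iff] at h3
    exact h3 (Finset.mem_Icc.2 ⟨hk1, hk2⟩) hk3

/-- Position of the crossing for a box `(j,c)` with entry `r`. -/
def posn (n j c r : ℕ) : ℤ × ℤ := ((n : ℤ) + j - c - r, (r : ℤ))

/-- The word of a list of positions. -/
def wL (n : ℕ) (l : List (ℤ × ℤ)) : Equiv.Perm ℤ :=
  (l.map fun p => sT (p.1 + p.2 - (n : ℤ) - 1)).prod

lemma wL_cons (n : ℕ) (a : ℤ × ℤ) (l : List (ℤ × ℤ)) :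
    wL n (a :: l) = sT (a.1 + a.2 - (n : ℤ) - 1) * wL n l := by
  simp [wL]

/-- Boxes of a shape. -/
def cells (n : ℕ) (μ : ℕ → ℕ) : Finset (Σ _ : ℕ, ℕ) :=
  (Finset.Icc 1 n).sigma fun j => Finset.range (μ j)

/-- The rc-graph of a tableau. -/
def RY {n : ℕ} {μ : ℕ → ℕ} (Y : SSYT n μ) : Finset (ℤ × ℤ) :=
  (cells n μ).image fun x => posn n x.1 x.2 (Y.entry x.1 x.2)

lemma mem_RY {n : ℕ} {μ : ℕ → ℕ} (Y : SSYT n μ) (p : ℤ × ℤ) :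
    p ∈ RY Y ↔ ∃ j c, 1 ≤ j ∧ j ≤ n ∧ c < μ j ∧ p = posn n j c (Y.entry j c) := by
  simp only [RY, cells, Finset.mem_image, Finset.mem_sigma, Finset.mem_Icc, Finset.mem_range]
  constructor
  · rintro ⟨⟨j, c⟩, ⟨⟨h1, h2⟩, h3⟩, rfl⟩
    exact ⟨j, c, h1, h2, h3, rfl⟩
  · rintro ⟨j, c, h1, h2, h3, rfl⟩
    exact ⟨⟨j, c⟩, ⟨⟨h1, h2⟩, h3⟩, rfl⟩

lemma diag_strict {n : ℕ} {μ : ℕ → ℕ} (hμ : IsPartition n μ) (Y : SSYT n μ) {j c j' c' : ℕ}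
    (hj : 1 ≤ j) (hlt : j < j') (hj' : j' ≤ n) (hc : c ≤ c') (hc' : c' < μ j') :
    Y.entry j c < Y.entry j' c' := by
  have := part_anti hμ hj hlt.le
  exact (Y.row_weak j c c' hj (by omega) hc (by omega)).trans_lt
    (Y.col_strict j j' c' hj hlt hj' hc')

lemma posn_inj {n : ℕ} {μ : ℕ → ℕ} (hμ : IsPartition n μ) (Y : SSYT n μ) {j c j' c' : ℕ}
    (hj : 1 ≤ j) (hjn : j ≤ n) (hj' : 1 ≤ j') (hjn' : j' ≤ n) (hc : c < μ j) (hc' : c' < μ j')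
    (h : posn n j c (Y.entry j c) = posn n j' c' (Y.entry j' c')) : j = j' ∧ c = c' := by
  simp only [posn, Prod.mk.injEq] at h
  rcases lt_trichotomy j j' with hlt | rfl | hlt
  · have := diag_strict hμ Y hj hlt hjn' (show c ≤ c' by omega) hc'
    omega
  · omega
  · have := diag_strict hμ Y hj' hlt hjn (show c' ≤ c by omega) hc
    omega

lemma entry_ge {n : ℕ} {μ : ℕ → ℕ} (hμ : IsPartition n μ) (Y : SSYT n μ) {j c : ℕ}
    (hj : 1 ≤ j) (hjn : j ≤ n) (hc : c < μ j) : j ≤ Y.entry j c := by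
  induction j, hj using Nat.le_induction with
  | base => exact (Y.entry_mem 1 c le_rfl hjn hc).1
  | succ j hj ih =>
    have := part_anti hμ hj (Nat.le_succ j)
    have h1 := ih (by omega) (by simp at this; omega)
    have h2 := Y.col_strict j (j + 1) c hj (by omega) hjn hc
    omega

/-- Direction A: the rc-graph of a tableau has the right permutation. -/
lemma gr_of_tableau (n : ℕ) (l : List (ℤ × ℤ)) : ∀ (μ : ℕ → ℕ), IsPartition n μ →
    ∀ Y : SSYT n μ, l.Pairwise rcOrder → l.Nodup → (∀ p, p ∈ l ↔ p ∈ RY Y) →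
    Gr (wL n l) μ := by
  induction l with
  | nil =>
    intro μ hμ Y _ _ h
    have h0 : μ = fun _ => 0 := by
      funext j
      by_contra hj
      have hj1 : ¬ (j = 0 ∨ n < j) := fun h => hj (hμ.2 j h)
      have := (h (posn n j 0 (Y.entry j 0))).2
        ((mem_RY Y _).2 ⟨j, 0, by omega, by omega, Nat.pos_of_ne_zero hj, rfl⟩)
      simp at this
    rw [h0]
    simpa [wL] using Gr_one
  | cons a t ih =>
    intro μ hμ Y hp hnd hmem
    rw [List.pairwise_cons] at hp
    rw [List.nodup_cons] at hnd
    obtain ⟨k, c, hk1, hkn, hc, rfl⟩ := (mem_RY Y a).1 ((hmem a).1 (List.mem_cons_self))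
    -- maximality
    have hmax : ∀ j d, 1 ≤ j → j ≤ n → d < μ j →
        rcOrder (posn n k c (Y.entry k c)) (posn n j d (Y.entry j d)) := by
      intro j d h1 h2 h3
      have := (hmem _).2 ((mem_RY Y _).2 ⟨j, d, h1, h2, h3, rfl⟩)
      rcases List.mem_cons.1 this with h | h
      · rw [h]; right; exact ⟨rfl, le_rfl⟩
      · exact hp.1 _ h
    simp only [rcOrder, posn] at hmax
    have hck : μ k = c + 1 := by
      by_contra hne
      have h1 := hmax k (c + 1) hk1 hkn (by omega)
      have h2 := Y.row_weak k c (c + 1) hk1 hkn (by omega) (by omega)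
      push_cast at h1
      omega
    have hbelow : ∀ j, k < j → μ j ≤ c := by
      intro j hj
      by_contra hne
      have hjn : j ≤ n := by
        by_contra h
        have := hμ.2 j (by omega)
        omega
      have h1 := hmax j c (by omega) hjn (by omega)
      have h2 := Y.col_strict k j c hk1 hj hjn (by omega)
      omega
    have habove : ∀ j, 1 ≤ j → j < k → c + 1 ≤ μ j := by
      intro j h1 h2
      rw [← hck]; exact part_anti hμ h1 h2.le
    let μ' := Function.update μ k c
    have hμ'k : μ' k = c := Function.update_self _ _ _
    have hμ'ne : ∀ j, j ≠ k → μ' j = μ j := fun j hj => Function.update_of_ne hj _ _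
    have hμ'le : ∀ j, μ' j ≤ μ j := by
      intro j
      by_cases hj : j = k
      · subst hj; omega
      · rw [hμ'ne j hj]
    have hμ' : IsPartition n μ' := by
      constructor
      · intro j h1 h2
        by_cases hj : j = k
        · rw [hj, hμ'k, hμ'ne _ (by omega)]
          exact hbelow _ (by omega)
        · rw [hμ'ne j hj]
          exact (hμ'le _).trans (hμ.1 j h1 h2)
      · intro j hj
        rw [hμ'ne j (by omega)]
        exact hμ.2 j hj
    have hin : ∀ j d, d < μ' j → ¬ (j = k ∧ d = c) := by
      rintro j d h ⟨rfl, rfl⟩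
      omega
    let Y' : SSYT n μ' :=
      { entry := fun j d => if j = k ∧ d = c then 0 else Y.entry j d
        entry_mem := by
          intro j d h1 h2 h3
          simp only [if_neg (hin j d h3)]
          exact Y.entry_mem j d h1 h2 (h3.trans_le (hμ'le j))
        row_weak := by
          intro j d e h1 h2 h3 h4
          simp only [if_neg (hin j e h4), if_neg (hin j d (by omega))]
          exact Y.row_weak j d e h1 h2 h3 (h4.trans_le (hμ'le j))
        col_strict := by
          intro j j' d h1 h2 h3 h4
          have h5 := part_anti hμ' h1 h2.le
          simp only [if_neg (hin j' d h4), if_neg (hin j d (by omega))]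
          exact Y.col_strict j j' d h1 h2 h3 (h4.trans_le (hμ'le j'))
        outside := by
          intro j d h
          by_cases hjd : j = k ∧ d = c
          · simp only [if_pos hjd]
          · simp only [if_neg hjd]
            apply Y.outside
            rcases h with h | h | h
            · exact Or.inl h
            · exact Or.inr (Or.inl h)
            · by_cases hj : j = k
              · right; right
                subst hj
                omega
              · rw [hμ'ne j hj] at h
                exact Or.inr (Or.inr h) }
    have hY' : ∀ j d, d < μ' j → Y'.entry j d = Y.entry j d := by
      intro j d h
      exact if_neg (hin j d h)
    have hG : Gr (wL n t) μ' := by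
      apply ih μ' hμ' Y' hp.2 hnd.2
      intro p
      rw [mem_RY]
      constructor
      · intro hpt
        obtain ⟨j, d, h1, h2, h3, h4⟩ := (mem_RY Y p).1 ((hmem p).1 (List.mem_cons_of_mem _ hpt))
        have h5 : d < μ' j := by
          by_cases hj : j = k
          · subst hj
            have : d ≠ c := by
              rintro rfl
              rw [h4] at hpt
              exact hnd.1 hpt
            omega
          · rw [hμ'ne j hj]; exact h3
        exact ⟨j, d, h1, h2, h5, by rw [hY' j d h5]; exact h4⟩
      · rintro ⟨j, d, h1, h2, h3, h4⟩
        rw [hY' j d h3] at h4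
        have h5 := (hmem p).2 ((mem_RY Y p).2 ⟨j, d, h1, h2, h3.trans_le (hμ'le j), h4⟩)
        rcases List.mem_cons.1 h5 with h6 | h6
        · exfalso
          rw [h6] at h4
          have := posn_inj hμ Y hk1 hkn h1 h2 hc (h3.trans_le (hμ'le j)) h4
          exact hin j d h3 ⟨this.1.symm, this.2.symm⟩
        · exact h6
    have hfin := Gr_step hG hk1 (by
      intro k' hk'
      rw [hG.1 k' hk', hμ'k]
      rcases lt_trichotomy k' k with h | h | h
      · have := habove k' hk' h
        rw [hμ'ne k' (by omega)]
        omega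
      · rw [h, hμ'k]; omega
      · have := hbelow k' h
        rw [hμ'ne k' (by omega)]
        omega)
    rw [hμ'k] at hfin
    have e1 : Function.update μ' k (c + 1) = μ := by
      rw [Function.update_idem, ← hck, Function.update_eq_self]
    rw [e1] at hfin
    rw [wL_cons]
    convert hfin using 3
    simp only [posn]; ring

lemma wL_map (n : ℕ) (l : List (ℤ × ℤ)) :
    wL n l = ((l.map fun p => p.1 + p.2 - (n : ℤ) - 1).map sT).prod := by
  simp [wL, Function.comp_def]

/-- Direction B: every reduced diagram of maximal energy comes from a tableau. -/
lemma tableau_of_list (n : ℕ) (l : List (ℤ × ℤ)) : l.Pairwise rcOrder →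
    (∀ p ∈ l, p.1 ≤ n ∧ p.2 ≤ n) → (l.length : ℤ) ≤ en n (wL n l) →
    ∃ (μ : ℕ → ℕ) (_ : IsPartition n μ) (Y : SSYT n μ),
      Gr (wL n l) μ ∧ ∀ p, p ∈ l ↔ p ∈ RY Y := by
  induction l with
  | nil =>
    intro _ _ _
    refine ⟨fun _ => 0, ⟨fun _ _ _ => le_rfl, fun _ _ => rfl⟩,
      ⟨fun _ _ => 0, ?_, ?_, ?_, ?_⟩, ?_, ?_⟩
    · intro j c _ _ h; omega
    · intro j c _ _ h; omega
    · intro j c _ _ h; omega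
    · intro j c _; rfl
    · simpa [wL] using Gr_one
    · intro p; rw [mem_RY]; simp
  | cons a t ih =>
    intro hp hle hen
    rw [List.pairwise_cons] at hp
    rw [wL_cons] at hen
    have hent : en n (wL n t) ≤ t.length := by
      have := en_le n (t.map fun p => p.1 + p.2 - (n : ℤ) - 1)
      rw [← wL_map, List.length_map] at this
      exact this
    rw [List.length_cons] at hen
    push_cast at hen
    obtain ⟨⟨k, hk1, hkn, hwk⟩, hfree⟩ := en_eq (show en n (wL n t) + 1 ≤ _ by linarith)
    have hent' : (t.length : ℤ) ≤ en n (wL n t) := by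
      rw [en_step] at hen
      have := card_le_one_aux n (wL n t) (a.1 + a.2 - n - 1 + 1)
      omega
    obtain ⟨μ, hμ, Y, hG, hmem⟩ := ih hp.2 (fun p hp => hle p (List.mem_cons_of_mem _ hp)) hent'
    have hale := hle a List.mem_cons_self
    rw [hG.1 k hk1] at hwk
    -- the letter
    have hj : a.1 + a.2 - (n : ℤ) - 1 = (k : ℤ) - μ k - 1 := by omega
    rw [hj] at hfree
    have hfree' : ∀ k' : ℕ, 1 ≤ k' → wL n t (k' : ℤ) ≠ (k : ℤ) - μ k - 1 := by
      intro k' hk'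
      rcases le_or_gt k' n with h | h
      · exact hfree k' hk' h
      · rw [hG.1 k' hk', hμ.2 k' (Or.inr h)]
        push_cast
        omega
    have habove : ∀ j, 1 ≤ j → j < k → μ k < μ j := by
      intro j h1 h2
      have h3 := part_anti hμ h1 (show j ≤ k - 1 by omega)
      have h4 := part_anti hμ (show 1 ≤ k - 1 by omega) (show k - 1 ≤ k by omega)
      have h5 := hfree' (k - 1) (by omega)
      rw [hG.1 (k - 1) (by omega)] at h5
      have : ((k - 1 : ℕ) : ℤ) = (k : ℤ) - 1 := by omega
      omega
    -- entry comparison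
    have hrow : ∀ j d, 1 ≤ j → j ≤ n → d < μ j →
        rcOrder a (posn n j d (Y.entry j d)) := by
      intro j d h1 h2 h3
      exact hp.1 _ ((hmem _).2 ((mem_RY Y _).2 ⟨j, d, h1, h2, h3, rfl⟩))
    simp only [rcOrder, posn] at hrow
    have ha2 : 1 ≤ a.2 := by
      rcases Nat.eq_zero_or_pos (μ k) with h0 | h0
      · omega
      · have h1 := hrow k 0 hk1 hkn h0
        have h2 := (Y.entry_mem k 0 hk1 hkn h0).1
        omega
    obtain ⟨r, hr⟩ := Int.eq_ofNat_of_zero_le (show 0 ≤ a.2 by omega)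
    let μ' := Function.update μ k (μ k + 1)
    have hμ'k : μ' k = μ k + 1 := Function.update_self _ _ _
    have hμ'ne : ∀ j, j ≠ k → μ' j = μ j := fun j hj => Function.update_of_ne hj _ _
    have hμ' : IsPartition n μ' := by
      constructor
      · intro j h1 h2
        by_cases hj : j + 1 = k
        · have := habove j h1 (by omega)
          rw [hj, hμ'k, hμ'ne j (by omega)]
          exact this
        · rw [hμ'ne _ hj]
          by_cases hj' : j = k
          · have := hμ.1 j h1 h2
            subst hj'
            omega
          · rw [hμ'ne j hj']
            exact hμ.1 j h1 h2
      · intro j hj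
        rw [hμ'ne j (by omega)]
        exact hμ.2 j hj
    have hold : ∀ j d, d < μ' j → ¬ (j = k ∧ d = μ k) → d < μ j := by
      intro j d h1 h2
      by_cases hj : j = k
      · subst hj
        have : d ≠ μ j := fun h => h2 ⟨rfl, h⟩
        omega
      · rw [hμ'ne j hj] at h1
        exact h1
    let Y' : SSYT n μ' :=
      { entry := fun j d => if j = k ∧ d = μ k then r else Y.entry j d
        entry_mem := by
          intro j d h1 h2 h3
          by_cases h : j = k ∧ d = μ k
          · simp only [if_pos h]
            omega
          · simp only [if_neg h]
            exact Y.entry_mem j d h1 h2 (hold j d h3 h)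
        row_weak := by
          intro j d e h1 h2 h3 h4
          by_cases h : j = k ∧ e = μ k
          · simp only [if_pos h]
            by_cases h' : j = k ∧ d = μ k
            · simp only [if_pos h', le_refl]
            · simp only [if_neg h']
              have := hrow j d h1 h2 (hold j d (by omega) h')
              omega
          · have he := hold j e h4 h
            have hd : ¬ (j = k ∧ d = μ k) := by
              rintro ⟨rfl, rfl⟩
              omega
            simp only [if_neg h, if_neg hd]
            exact Y.row_weak j d e h1 h2 h3 he
        col_strict := by
          intro j j' d h1 h2 h3 h4
          by_cases h : j' = k ∧ d = μ k
          · have h' : ¬ (j = k ∧ d = μ k) := by omega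
            simp only [if_pos h, if_neg h']
            have h5 := habove j h1 (by omega)
            have h6 := hrow j d h1 (by omega) (by omega)
            omega
          · have hd := hold j' d h4 h
            have h' : ¬ (j = k ∧ d = μ k) := by
              rintro ⟨rfl, rfl⟩
              have := part_anti hμ h1 h2.le
              omega
            simp only [if_neg h, if_neg h']
            exact Y.col_strict j j' d h1 h2 h3 hd
        outside := by
          intro j d h
          have hjd : ¬ (j = k ∧ d = μ k) := by
            rintro ⟨rfl, rfl⟩
            omega
          simp only [if_neg hjd]
          apply Y.outside
          by_cases hj : j = k
          · subst hj; omega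
          · rw [hμ'ne j hj] at h
            exact h }
    have hY'k : Y'.entry k (μ k) = r := if_pos ⟨rfl, rfl⟩
    have hY' : ∀ j d, ¬ (j = k ∧ d = μ k) → Y'.entry j d = Y.entry j d := fun j d h => if_neg h
    have hapos : a = posn n k (μ k) r := by
      apply Prod.ext
      · simp only [posn]; omega
      · simp only [posn]; omega
    refine ⟨μ', hμ', Y', ?_, ?_⟩
    · rw [wL_cons, hj]
      exact Gr_step hG hk1 hfree'
    · intro p
      rw [List.mem_cons, hmem, mem_RY, mem_RY]
      constructor
      · rintro (rfl | ⟨j, d, h1, h2, h3, h4⟩)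
        · exact ⟨k, μ k, hk1, hkn, by omega, by rw [hY'k]; exact hapos⟩
        · have h5 : ¬ (j = k ∧ d = μ k) := by
            rintro ⟨rfl, rfl⟩
            omega
          refine ⟨j, d, h1, h2, ?_, by rw [hY' j d h5]; exact h4⟩
          by_cases hj : j = k
          · subst hj; omega
          · rw [hμ'ne j hj]; exact h3
      · rintro ⟨j, d, h1, h2, h3, h4⟩
        by_cases h5 : j = k ∧ d = μ k
        · left
          obtain ⟨rfl, rfl⟩ := h5
          rw [h4, hY'k]; exact hapos.symm
        · right
          rw [hY' j d h5] at h4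
          exact ⟨j, d, h1, h2, hold j d h3 h5, h4⟩

lemma gr_RY {n : ℕ} {μ : ℕ → ℕ} (hμ : IsPartition n μ) (Y : SSYT n μ) :
    Gr (wR n (RY Y)) μ :=
  gr_of_tableau n ((RY Y).sort rcOrder) μ hμ Y (Finset.pairwise_sort _ _)
    (Finset.sort_nodup _ _) (fun p => Finset.mem_sort _)

/-- The tableau with all entries of row `j` equal to `j`. -/
def topY (n : ℕ) (μ : ℕ → ℕ) : SSYT n μ where
  entry j c := if 1 ≤ j ∧ j ≤ n ∧ c < μ j then j else 0
  entry_mem j c h1 h2 h3 := by rw [if_pos ⟨h1, h2, h3⟩]; exact ⟨h1, h2⟩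
  row_weak j c d h1 h2 h3 h4 := by
    rw [if_pos (show 1 ≤ j ∧ j ≤ n ∧ d < μ j from ⟨h1, h2, h4⟩), if_pos ⟨h1, h2, by omega⟩]
  col_strict j j' c h1 h2 h3 h4 := by
    rw [if_pos (show 1 ≤ j' ∧ j' ≤ n ∧ c < μ j' from ⟨by omega, h3, h4⟩)]
    split_ifs <;> omega
  outside j c h := if_neg (by omega)

lemma RY_topY (n : ℕ) (μ : ℕ → ℕ) : RY (topY n μ) = Rmu n μ := by
  ext ⟨i, k⟩
  rw [mem_RY]
  simp only [Rmu, Finset.mem_biUnion, Finset.mem_image, Finset.mem_Icc, Prod.mk.injEq, topY, posn]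
  constructor
  · rintro ⟨j, c, h1, h2, h3, h4, h5⟩
    rw [if_pos ⟨h1, h2, h3⟩] at h4 h5
    refine ⟨(j : ℤ), by omega, i, ?_, rfl, h5.symm⟩
    rw [Int.toNat_natCast]
    omega
  · rintro ⟨k', h1, i', h2, rfl, rfl⟩
    refine ⟨k'.toNat, (n - i').toNat, by omega, by omega, by omega, ?_⟩
    rw [if_pos ⟨by omega, by omega, by omega⟩]
    omega

lemma card_RY {n : ℕ} {μ : ℕ → ℕ} (hμ : IsPartition n μ) (Y : SSYT n μ) :
    (RY Y).card = ∑ j ∈ Finset.Icc 1 n, μ j := by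
  rw [RY, Finset.card_image_of_injOn]
  · simp [cells]
  · rintro ⟨j, c⟩ h ⟨j', c'⟩ h' he
    simp only [cells, Finset.coe_sigma, Set.mem_sigma_iff, Finset.mem_coe, Finset.mem_Icc,
      Finset.mem_range] at h h'
    obtain ⟨rfl, rfl⟩ := posn_inj hμ Y h.1.1 h.1.2 h'.1.1 h'.1.2 h.2 h'.2 he
    rfl

lemma en_Gr {n : ℕ} {μ : ℕ → ℕ} {w : Equiv.Perm ℤ} (h : Gr w μ) :
    en n w = ((∑ j ∈ Finset.Icc 1 n, μ j : ℕ) : ℤ) := by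
  unfold en
  push_cast
  apply Finset.sum_congr rfl
  intro k hk
  rw [h.1 k (Finset.mem_Icc.1 hk).1]
  ring

lemma len_Gr {n : ℕ} {μ : ℕ → ℕ} (hμ : IsPartition n μ) {w : Equiv.Perm ℤ} (h : Gr w μ) :
    len w = ∑ j ∈ Finset.Icc 1 n, μ j := by
  have hw : w = wR n (RY (topY n μ)) := Gr_unique h (gr_RY hμ _)
  have hex : (∑ j ∈ Finset.Icc 1 n, μ j) ∈
      {m : ℕ | ∃ l : List ℤ, l.length = m ∧ (l.map sT).prod = w} := by
    refine ⟨((RY (topY n μ)).sort rcOrder).map fun p => p.1 + p.2 - (n : ℤ) - 1, ?_, ?_⟩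
    · rw [List.length_map, Finset.length_sort, card_RY hμ]
    · rw [← wL_map, hw]; rfl
  apply le_antisymm (Nat.sInf_le hex)
  obtain ⟨l, hl, hl'⟩ := Nat.sInf_mem ⟨_, hex⟩
  have := en_le n l
  rw [hl', en_Gr h, hl] at this
  exact_mod_cast this

lemma isRC_RY {n : ℕ} {μ : ℕ → ℕ} (hμ : IsPartition n μ) (Y : SSYT n μ) : IsRC n (RY Y) := by
  constructor
  · intro p hp
    obtain ⟨j, c, h1, h2, h3, rfl⟩ := (mem_RY Y p).1 hp
    have h4 := entry_ge hμ Y h1 h2 h3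
    have h5 := Y.entry_mem j c h1 h2 h3
    simp only [posn]
    omega
  · rw [len_Gr hμ (gr_RY hμ Y), card_RY hμ]

lemma SSYT_ext {n : ℕ} {μ : ℕ → ℕ} {Y Y' : SSYT n μ} (h : Y.entry = Y'.entry) : Y = Y' := by
  cases Y; cases Y'; simp only at h; subst h; rfl

lemma RY_le {n : ℕ} {μ : ℕ → ℕ} (hμ : IsPartition n μ) {Y Y' : SSYT n μ} (h : RY Y ⊆ RY Y')
    {k c : ℕ} (hk : 1 ≤ k) (hkn : k ≤ n) (hc : c < μ k)
    (ih : ∀ j, j < k → ∀ d, Y.entry j d = Y'.entry j d) : Y'.entry k c ≤ Y.entry k c := by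
  obtain ⟨j, d, h1, h2, h3, h4⟩ := (mem_RY Y' _).1 (h ((mem_RY Y _).2 ⟨k, c, hk, hkn, hc, rfl⟩))
  simp only [posn, Prod.mk.injEq] at h4
  rcases lt_trichotomy j k with hlt | rfl | hlt
  · have h5 := diag_strict hμ Y h1 hlt hkn (show d ≤ c by omega) hc
    rw [ih j hlt d] at h5
    omega
  · have : c = d := by omega
    subst this
    omega
  · have h5 := diag_strict hμ Y' hk hlt h2 (show c ≤ d by omega) h3
    omega

lemma RY_inj {n : ℕ} {μ : ℕ → ℕ} (hμ : IsPartition n μ) {Y Y' : SSYT n μ} (h : RY Y = RY Y') :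
    Y = Y' := by
  apply SSYT_ext
  have : ∀ k c, Y.entry k c = Y'.entry k c := by
    intro k
    induction k using Nat.strong_induction_on with
    | _ k ih =>
      intro c
      by_cases hin : 1 ≤ k ∧ k ≤ n ∧ c < μ k
      · exact le_antisymm
          (RY_le hμ h.symm.subset hin.1 hin.2.1 hin.2.2 (fun j hj d => (ih j hj d).symm))
          (RY_le hμ h.subset hin.1 hin.2.1 hin.2.2 ih)
      · rw [Y.outside k c (by omega), Y'.outside k c (by omega)]
  funext k c
  exact this k c

lemma RY_surj {n : ℕ} {μ : ℕ → ℕ} (hμ : IsPartition n μ) {R : Finset (ℤ × ℤ)} (hR : IsRC n R)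
    (hw : Gr (wR n R) μ) : ∃ Y : SSYT n μ, RY Y = R := by
  have hlen : ((R.sort rcOrder).length : ℤ) ≤ en n (wL n (R.sort rcOrder)) := by
    rw [Finset.length_sort, ← hR.2, len_Gr hμ hw]
    exact (en_Gr (n := n) hw).ge
  obtain ⟨ν, hν, Y, hG, hmem⟩ := tableau_of_list n (R.sort rcOrder) (Finset.pairwise_sort _ _)
    (fun p hp => hR.1 p ((Finset.mem_sort _).1 hp)) hlen
  have hνμ : ν = μ := by
    funext k
    rcases Nat.eq_zero_or_pos k with h | h
    · rw [hν.2 k (Or.inl h), hμ.2 k (Or.inl h)]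
    · have h1 := hG.1 k h
      have h2 : wL n (R.sort rcOrder) (k : ℤ) = k - μ k := hw.1 k h
      omega
  subst hνμ
  refine ⟨Y, ?_⟩
  ext p
  rw [← hmem, Finset.mem_sort]

lemma list_prod_range {M : Type*} [CommMonoid M] (f : ℕ → M) (m : ℕ) :
    ((List.range m).map f).prod = ∏ i ∈ Finset.range m, f i := by
  induction m with
  | zero => simp
  | succ m ih => rw [List.range_succ, Finset.prod_range_succ, ← ih]; simp

lemma prod_flatMap_aux {α M : Type*} [CommMonoid M] (l : List α) (f : α → List M) :
    (l.flatMap f).prod = (l.map fun x => (f x).prod).prod := by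
  induction l with
  | nil => simp
  | cons a t ih => simp [List.flatMap_cons, ih]

lemma prod_rows_aux {M : Type*} [CommMonoid M] (f : ℕ → M) (n : ℕ) :
    (((List.range n).reverse.map (· + 1)).map f).prod = ∏ j ∈ Finset.Icc 1 n, f j := by
  rw [List.map_map, List.map_reverse, List.prod_reverse, list_prod_range]
  induction n with
  | zero => simp
  | succ n ih =>
    rw [Finset.prod_range_succ, ih, Finset.prod_Icc_succ_top (by omega)]
    rfl

lemma xR_RY {n : ℕ} {μ : ℕ → ℕ} (hμ : IsPartition n μ) (Y : SSYT n μ) :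
    xR (RY Y) = xY n μ Y := by
  rw [xR, RY, Finset.prod_image, cells, Finset.prod_sigma, xY, readingWord]
  · rw [List.map_flatMap, prod_flatMap_aux, prod_rows_aux]
    apply Finset.prod_congr rfl
    intro j _
    rw [List.map_map, list_prod_range]
    apply Finset.prod_congr rfl
    intro c _
    simp [posn]
  · rintro ⟨j, c⟩ h ⟨j', c'⟩ h' he
    simp only [cells, Finset.coe_sigma, Set.mem_sigma_iff, Finset.mem_coe, Finset.mem_Icc,
      Finset.mem_range] at h h'
    obtain ⟨rfl, rfl⟩ := posn_inj hμ Y h.1.1 h.1.2 h'.1.1 h'.1.2 h.2 h'.2 he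
    rfl

/-- For every partition `μ` there is a weight-preserving bijection
`Y ↦ R(Y)` between semistandard Young tableaux of shape `μ` with entries in `{1,…,n}`
and rc-graphs `R` with `w_R = w(μ)`. -/
theorem ssyt_equiv_rcgraphs (n : ℕ) (hn : 0 < n) (μ : ℕ → ℕ) (hμ : IsPartition n μ) :
    ∃ e : SSYT n μ ≃ {R : Finset (ℤ × ℤ) // IsRC n R ∧ wR n R = wR n (Rmu n μ)},
      ∀ Y : SSYT n μ, xR (e Y).val = xY n μ Y := by
  have htop : Gr (wR n (Rmu n μ)) μ := by
    rw [← RY_topY]; exact gr_RY hμ _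
  refine ⟨Equiv.ofBijective
    (fun Y => ⟨RY Y, isRC_RY hμ Y, Gr_unique (gr_RY hμ Y) htop⟩) ⟨?_, ?_⟩, ?_⟩
  · intro Y Y' h
    exact RY_inj hμ (congrArg Subtype.val h)
  · rintro ⟨R, hR, hw⟩
    obtain ⟨Y, rfl⟩ := RY_surj hμ hR (by rw [hw]; exact htop)
    exact ⟨Y, rfl⟩
  · intro Y
    exact xR_RY hμ Y

end RCGraphs
end
end

section
/- If Y₁ and Y₂ are two distinct semistandard Young tableaux (of any shapes, with entries in {1,…,n}), then their reading words v(Y₁) and v(Y₂) are not Knuth equivalent; moreover, every word with letters in {1,…,n} is Knuth equivalent to the reading word v(Y) of exactly one semistandard Young tableau Y. -/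
open scoped Classical

noncomputable section

namespace RCGraphs

/-! ### Row insertion -/

/-- Row insertion of a letter: the new row and the (empty or singleton) bumped word. -/
def rins : List ℕ → ℕ → List ℕ × List ℕ
  | [], x => ([x], [])
  | a :: r, x => if x < a then (x :: r, [a]) else (a :: (rins r x).1, (rins r x).2)

/-- Row insertion of a word: the final row and the bumped word. -/
def wins : List ℕ → List ℕ → List ℕ × List ℕ
  | r, [] => (r, [])
  | r, x :: w => ((wins (rins r x).1 w).1, (rins r x).2 ++ (wins (rins r x).1 w).2)

/-- The `k`-th row of the insertion tableau of a word. -/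
def rowP : ℕ → List ℕ → List ℕ
  | 0, w => (wins [] w).1
  | k + 1, w => rowP k (wins [] w).2

/-- Strict domination of the columns of two consecutive rows. -/
def Dom : List ℕ → List ℕ → Prop
  | _, [] => True
  | [], _ :: _ => False
  | a :: r, b :: s => a < b ∧ Dom r s

/-- Tableaux as lists of rows. -/
def Tab : List (List ℕ) → Prop
  | [] => True
  | R :: L => R.Pairwise (· ≤ ·) ∧ Dom R (L.headD []) ∧ Tab L

/-- Reading word of a list of rows. -/
def wordOf (L : List (List ℕ)) : List ℕ := L.reverse.flatten

/-- Insertion of a letter in a tableau. -/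
def tins : List (List ℕ) → ℕ → List (List ℕ)
  | [], x => [[x]]
  | R :: L, x =>
    match (rins R x).2 with
    | [] => (rins R x).1 :: L
    | b :: _ => (rins R x).1 :: tins L b

theorem wordOf_cons (R : List ℕ) (L : List (List ℕ)) : wordOf (R :: L) = wordOf L ++ R := by
  simp [wordOf]

theorem KE_refl (w : List ℕ) : KnuthEquiv w w := Relation.EqvGen.refl w

theorem KE_symm {w w' : List ℕ} (h : KnuthEquiv w w') : KnuthEquiv w' w :=
  Relation.EqvGen.symm _ _ h

theorem KE_trans {w w' w'' : List ℕ} (h : KnuthEquiv w w') (h' : KnuthEquiv w' w'') :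
    KnuthEquiv w w'' := Relation.EqvGen.trans _ _ _ h h'

theorem KE_ctx (p q : List ℕ) {w w' : List ℕ} (h : KnuthEquiv w w') :
    KnuthEquiv (p ++ w ++ q) (p ++ w' ++ q) := by
  induction h with
  | rel a b h =>
    apply Relation.EqvGen.rel
    rcases h with ⟨u, v, x, y, z, h1, h2, rfl, rfl⟩ | ⟨u, v, x, y, z, h1, h2, rfl, rfl⟩
    · left
      exact ⟨p ++ u, v ++ q, x, y, z, h1, h2, by simp, by simp⟩
    · right
      exact ⟨p ++ u, v ++ q, x, y, z, h1, h2, by simp, by simp⟩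
  | refl a => exact KE_refl _
  | symm a b _ ih => exact KE_symm ih
  | trans a b c _ _ ih1 ih2 => exact KE_trans ih1 ih2

theorem KE_left (p : List ℕ) {w w' : List ℕ} (h : KnuthEquiv w w') :
    KnuthEquiv (p ++ w) (p ++ w') := by simpa using KE_ctx p [] h

theorem KE_right (q : List ℕ) {w w' : List ℕ} (h : KnuthEquiv w w') :
    KnuthEquiv (w ++ q) (w' ++ q) := by simpa using KE_ctx [] q h

theorem KE_cons (a : ℕ) {w w' : List ℕ} (h : KnuthEquiv w w') :
    KnuthEquiv (a :: w) (a :: w') := by simpa using KE_left [a] h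

theorem KE_one {x y z : ℕ} (v : List ℕ) (h1 : x < y) (h2 : y ≤ z) :
    KnuthEquiv (y :: x :: z :: v) (y :: z :: x :: v) :=
  Relation.EqvGen.rel _ _ (Or.inl ⟨[], v, x, y, z, h1, h2, rfl, rfl⟩)

theorem KE_two {x y z : ℕ} (v : List ℕ) (h1 : x ≤ y) (h2 : y < z) :
    KnuthEquiv (x :: z :: y :: v) (z :: x :: y :: v) :=
  Relation.EqvGen.rel _ _ (Or.inr ⟨[], v, x, y, z, h1, h2, rfl, rfl⟩)

theorem rins_mem {r : List ℕ} {x c : ℕ} (h : c ∈ (rins r x).1) : c ∈ r ∨ c = x := by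
  induction r with
  | nil => simp [rins] at h; exact Or.inr h
  | cons a r ih =>
    by_cases hx : x < a
    · simp [rins, hx] at h ⊢; tauto
    · simp [rins, hx] at h ⊢; tauto

theorem rins_bump (r : List ℕ) (x : ℕ) :
    (rins r x).2 = [] ∨ ∃ b, (rins r x).2 = [b] ∧ x < b ∧ b ∈ r := by
  induction r with
  | nil => simp [rins]
  | cons a r ih =>
    by_cases hx : x < a
    · simp [rins, hx]
    · simp only [rins, hx, if_false]
      rcases ih with h | ⟨b, h, h1, h2⟩
      · exact Or.inl h
      · exact Or.inr ⟨b, h, h1, by simp [h2]⟩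

theorem rins_sorted {r : List ℕ} (x : ℕ) (h : r.Pairwise (· ≤ ·)) :
    (rins r x).1.Pairwise (· ≤ ·) := by
  induction r with
  | nil => simp [rins]
  | cons a r ih =>
    rw [List.pairwise_cons] at h
    by_cases hx : x < a
    · simp only [rins, hx, if_true, List.pairwise_cons]
      exact ⟨fun c hc => by have := h.1 c hc; omega, h.2⟩
    · simp only [rins, hx, if_false, List.pairwise_cons]
      refine ⟨fun c hc => ?_, ih h.2⟩
      rcases rins_mem hc with h' | h'
      · exact h.1 c h'
      · omega

theorem wins_sorted {r : List ℕ} (w : List ℕ) (h : r.Pairwise (· ≤ ·)) :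
    (wins r w).1.Pairwise (· ≤ ·) := by
  induction w generalizing r with
  | nil => simpa [wins]
  | cons x w ih => exact ih (rins_sorted x h)

theorem wins_append (r u v : List ℕ) :
    wins r (u ++ v) =
      ((wins (wins r u).1 v).1, (wins r u).2 ++ (wins (wins r u).1 v).2) := by
  induction u generalizing r with
  | nil => simp [wins]
  | cons x u ih => simp [wins, ih]

/-- Inserting `y ≤ z` in a row: bumped letters come in weakly increasing order. -/
theorem rins_le {r : List ℕ} {y z : ℕ} (h : r.Pairwise (· ≤ ·)) (hyz : y ≤ z) :
    (rins (rins r y).1 z).2 = [] ∨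
      ∃ b c, (rins r y).2 = [b] ∧ (rins (rins r y).1 z).2 = [c] ∧ y < b ∧ b ≤ c := by
  induction r with
  | nil =>
    have hz : ¬ z < y := by omega
    left; simp [rins, hz]
  | cons a r ih =>
    rw [List.pairwise_cons] at h
    by_cases hy : y < a
    · have hz : ¬ z < y := by omega
      simp only [rins, hy, if_true, hz, if_false]
      rcases rins_bump r z with h' | ⟨b, h1, h2, h3⟩
      · exact Or.inl h'
      · exact Or.inr ⟨a, b, rfl, h1, hy, h.1 b h3⟩
    · have hz : ¬ z < a := by omega
      simp only [rins, hy, hz, if_false]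
      exact ih h.2

/-- Inserting `z` and then `y < z` in a row. -/
theorem rins_gt {r : List ℕ} {y z : ℕ} (hyz : y < z) :
    ∃ c, (rins (rins r z).1 y).2 = [c] ∧ c ≤ z ∧ (c ∈ r ∨ c = z) := by
  induction r with
  | nil => exact ⟨z, by simp [rins, hyz]⟩
  | cons a r ih =>
    by_cases hz : z < a
    · exact ⟨z, by simp [rins, hz, hyz]⟩
    · by_cases hy : y < a
      · exact ⟨a, by simp [rins, hz, hy]; omega⟩
      · obtain ⟨c, h1, h2, h3⟩ := ih
        refine ⟨c, by simpa [rins, hz, hy] using h1, h2, ?_⟩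
        rcases h3 with h3 | h3 <;> simp [h3]

theorem wins_one {r : List ℕ} {x y z : ℕ} (h : r.Pairwise (· ≤ ·)) (hxy : x < y) (hyz : y ≤ z) :
    (wins r [y, x, z]).1 = (wins r [y, z, x]).1 ∧
      KnuthEquiv (wins r [y, x, z]).2 (wins r [y, z, x]).2 := by
  induction r with
  | nil =>
    have h1 : ¬ z < x := by omega
    have h2 : ¬ z < y := by omega
    simp [wins, rins, hxy, h1, h2, KE_refl]
  | cons a r ih =>
    rw [List.pairwise_cons] at h
    have h1 : ¬ z < x := by omega
    have h2 : ¬ z < y := by omega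
    by_cases hy : y < a
    · have hx : x < a := by omega
      simp only [wins, rins, hy, hx, hxy, h1, h2, if_true, if_false, true_and]
      rcases rins_bump r z with h' | ⟨b, h3, h4, h5⟩
      · simp [h', KE_refl]
      · simp only [h3]
        exact KE_one [] hy (h.1 b h5)
    · have hz : ¬ z < a := by omega
      by_cases hx : x < a
      · simp only [wins, rins, hy, hx, hz, h1, if_true, if_false, true_and]
        rcases rins_le h.2 hyz with h' | ⟨b, c, h3, h4, h5, h6⟩
        · simp [h', KE_refl]
        · simp only [h3, h4]
          exact KE_one [] (by omega) h6
      · have := ih h.2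
        simp only [wins, rins, hy, hx, hz, if_false] at this ⊢
        exact ⟨by rw [this.1], this.2⟩

theorem wins_two {r : List ℕ} {x y z : ℕ} (h : r.Pairwise (· ≤ ·)) (hxy : x ≤ y) (hyz : y < z) :
    (wins r [x, z, y]).1 = (wins r [z, x, y]).1 ∧
      KnuthEquiv (wins r [x, z, y]).2 (wins r [z, x, y]).2 := by
  have h1 : ¬ z < x := by omega
  have h2 : ¬ y < x := by omega
  have h3 : x < z := by omega
  induction r with
  | nil => simp [wins, rins, h1, h2, h3, hyz, KE_refl]
  | cons a r ih =>
    rw [List.pairwise_cons] at h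
    by_cases hz : z < a
    · have hx : x < a := by omega
      cases r with
      | nil => simp [wins, rins, h1, h2, h3, hx, hz, hyz, KE_refl]
      | cons c r =>
        have hac : a ≤ c := h.1 c (by simp)
        have hzc : z < c := by omega
        have hyc : y < c := by omega
        simp only [wins, rins, hx, hz, h1, h2, h3, hzc, hyc, hyz, if_true, if_false, true_and]
        exact KE_symm (KE_one [] hz hac)
    · by_cases hx : x < a
      · obtain ⟨c, h4, h5, h6⟩ := rins_gt (r := r) hyz
        have hac : a ≤ c := by
          rcases h6 with h6 | h6
          · exact h.1 c h6
          · omega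
        simp only [wins, rins, hx, hz, h1, h2, if_true, if_false, true_and, h4]
        rcases rins_bump r z with h' | ⟨b, h7, h8, h9⟩
        · simp [h', KE_refl]
        · simp only [h7]
          exact KE_two [] hac (by omega)
      · have hy : ¬ y < a := by omega
        have := ih h.2
        simp only [wins, rins, hy, hx, hz, if_false] at this ⊢
        exact ⟨by rw [this.1], this.2⟩

theorem wins_move {w w' : List ℕ} (h : KnuthMove w w') :
    (wins [] w).1 = (wins [] w').1 ∧ KnuthEquiv (wins [] w).2 (wins [] w').2 := by
  have key : ∀ (u t t' v : List ℕ),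
      ((wins (wins [] u).1 t).1 = (wins (wins [] u).1 t').1 ∧
        KnuthEquiv (wins (wins [] u).1 t).2 (wins (wins [] u).1 t').2) →
      (wins [] (u ++ (t ++ v))).1 = (wins [] (u ++ (t' ++ v))).1 ∧
        KnuthEquiv (wins [] (u ++ (t ++ v))).2 (wins [] (u ++ (t' ++ v))).2 := by
    intro u t t' v ⟨h1, h2⟩
    simp only [wins_append, h1, true_and]
    exact KE_left _ (KE_right _ h2)
  rcases h with ⟨u, v, x, y, z, h1, h2, rfl, rfl⟩ | ⟨u, v, x, y, z, h1, h2, rfl, rfl⟩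
  · exact key u [y, x, z] [y, z, x] v (wins_one (wins_sorted u List.Pairwise.nil) h1 h2)
  · exact key u [x, z, y] [z, x, y] v (wins_two (wins_sorted u List.Pairwise.nil) h1 h2)

theorem wins_equiv {w w' : List ℕ} (h : KnuthEquiv w w') :
    (wins [] w).1 = (wins [] w').1 ∧ KnuthEquiv (wins [] w).2 (wins [] w').2 := by
  induction h with
  | rel a b h => exact wins_move h
  | refl a => exact ⟨rfl, KE_refl _⟩
  | symm a b _ ih => exact ⟨ih.1.symm, KE_symm ih.2⟩
  | trans a b c _ _ ih1 ih2 => exact ⟨ih1.1.trans ih2.1, KE_trans ih1.2 ih2.2⟩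

theorem rowP_equiv (k : ℕ) {w w' : List ℕ} (h : KnuthEquiv w w') : rowP k w = rowP k w' := by
  induction k generalizing w w' with
  | zero => exact (wins_equiv h).1
  | succ k ih => exact ih (wins_equiv h).2

/-! ### The insertion tableau of a reading word -/

theorem wins_pass {a : ℕ} {w : List ℕ} (s : List ℕ) (h : ∀ x ∈ w, a ≤ x) :
    wins (a :: s) w = (a :: (wins s w).1, (wins s w).2) := by
  induction w generalizing s with
  | nil => simp [wins]
  | cons x w ih =>
    have hx : ¬ x < a := by have := h x (by simp); omega
    have := fun s => ih s (fun y hy => h y (by simp [hy]))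
    simp [wins, rins, hx, this]

theorem wins_row {r s : List ℕ} (h : r.Pairwise (· ≤ ·)) (hd : Dom r s) :
    wins s r = (r, s) := by
  induction r generalizing s with
  | nil =>
    cases s with
    | nil => rfl
    | cons b s => exact hd.elim
  | cons a r ih =>
    rw [List.pairwise_cons] at h
    cases s with
    | nil =>
      have := ih (s := []) h.2 (by cases r <;> trivial)
      simp [wins, rins, wins_pass [] h.1, this]
    | cons b s =>
      have := ih (s := s) h.2 hd.2
      simp [wins, rins, hd.1, wins_pass s h.1, this]

theorem wins_wordOf {R : List ℕ} {L : List (List ℕ)} (h : Tab (R :: L)) :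
    wins [] (wordOf (R :: L)) = (R, wordOf L) := by
  induction L generalizing R with
  | nil =>
    have := wins_row h.1 h.2.1
    simpa [wordOf] using this
  | cons S L ih =>
    have h1 := ih h.2.2
    have h2 := wins_row h.1 h.2.1
    rw [wordOf_cons, wins_append, h1]
    simp only [List.headD_cons] at h2
    simp [h2, wordOf_cons]

theorem rowP_wordOf {L : List (List ℕ)} (h : Tab L) (k : ℕ) (hk : k < L.length) :
    rowP k (wordOf L) = L.getD k [] := by
  induction k generalizing L with
  | zero =>
    cases L with
    | nil => simp at hk
    | cons R L => simp [rowP, wins_wordOf h]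
  | succ k ih =>
    cases L with
    | nil => simp at hk
    | cons R L =>
      simp only [rowP, wins_wordOf h]
      rw [ih h.2.2 (by simpa using hk)]
      simp

/-! ### Existence -/

theorem KE_shift {a x : ℕ} {r : List ℕ} (h : (a :: r).Pairwise (· ≤ ·)) (hx : x < a) :
    KnuthEquiv (a :: (r ++ [x])) (a :: x :: r) := by
  induction r generalizing a with
  | nil => exact KE_refl _
  | cons c r ih =>
    rw [List.pairwise_cons] at h
    have hac := h.1 c (by simp)
    refine KE_trans (KE_cons a (ih h.2 (by omega))) ?_
    exact KE_symm (KE_one r hx hac)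

theorem rins_head {r : List ℕ} {x b : ℕ} (h : (rins r x).2 = [b]) :
    ∃ c s, (rins r x).1 = c :: s ∧ c ≤ x ∧ x < b := by
  have hb : x < b := by
    rcases rins_bump r x with h' | ⟨b', h1, h2, _⟩
    · simp [h'] at h
    · rw [h1] at h
      simp at h
      omega
  cases r with
  | nil => simp [rins] at h
  | cons a r =>
    by_cases hx : x < a
    · exact ⟨x, r, by simp [rins, hx], le_refl _, hb⟩
    · exact ⟨a, (rins r x).1, by simp [rins, hx], by omega, hb⟩

theorem KE_rins {r : List ℕ} (x : ℕ) (h : r.Pairwise (· ≤ ·)) :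
    KnuthEquiv (r ++ [x]) ((rins r x).2 ++ (rins r x).1) := by
  induction r with
  | nil => exact KE_refl _
  | cons a r ih =>
    by_cases hx : x < a
    · simpa [rins, hx] using KE_shift h hx
    · rw [List.pairwise_cons] at h
      have h0 := KE_cons a (ih h.2)
      simp only [rins, hx, if_false]
      refine KE_trans h0 ?_
      rcases rins_bump r x with h' | ⟨b, h1, h2, h3⟩
      · simp [h', KE_refl]
      · obtain ⟨c, s, h4, h5, h6⟩ := rins_head h1
        have hac : a ≤ c := by
          have : c ∈ (rins r x).1 := by simp [h4]
          rcases rins_mem this with h7 | h7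
          · exact h.1 c h7
          · omega
        rw [h1, h4]
        exact KE_two s hac (by omega)

theorem KE_tins {L : List (List ℕ)} (x : ℕ) (h : Tab L) :
    KnuthEquiv (wordOf L ++ [x]) (wordOf (tins L x)) := by
  induction L generalizing x with
  | nil => exact KE_refl _
  | cons R L ih =>
    have h1 := KE_left (wordOf L) (KE_rins x h.1)
    rw [wordOf_cons, List.append_assoc]
    refine KE_trans h1 ?_
    rcases rins_bump R x with h' | ⟨b, h', _, _⟩
    · simp [tins, h', wordOf_cons, KE_refl]
    · simp only [tins, h', wordOf_cons]
      rw [← List.append_assoc]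
      exact KE_right _ (ih b h.2.2)

theorem Dom_nil (r : List ℕ) : Dom r [] := by cases r <;> trivial

theorem Dom_rins {r s : List ℕ} (x : ℕ) (h : Dom r s) : Dom (rins r x).1 s := by
  induction r generalizing s with
  | nil =>
    cases s with
    | nil => exact Dom_nil _
    | cons b s => exact h.elim
  | cons a r ih =>
    cases s with
    | nil => exact Dom_nil _
    | cons b s =>
      have h1 : a < b := h.1
      by_cases hx : x < a
      · simp only [rins, hx, if_true]
        exact ⟨by omega, h.2⟩
      · simp only [rins, hx, if_false]
        exact ⟨h1, ih h.2⟩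

theorem Dom_rins_rins {r s : List ℕ} {x b : ℕ} (h : Dom r s) (hb : (rins r x).2 = [b]) :
    Dom (rins r x).1 (rins s b).1 := by
  induction r generalizing s with
  | nil => simp [rins] at hb
  | cons a r ih =>
    have hxb : x < b := (rins_head hb).choose_spec.choose_spec.2.2
    by_cases hx : x < a
    · simp [rins, hx] at hb
      subst hb
      cases s with
      | nil => simpa [rins, hx, Dom] using Dom_nil r
      | cons c s => simpa [rins, hx, Dom, h.1] using h.2
    · simp only [rins, hx, if_false] at hb ⊢
      cases s with
      | nil => exact ⟨by omega, Dom_nil _⟩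
      | cons c s =>
        by_cases hc : b < c
        · simp only [rins, hc, if_true]
          exact ⟨by omega, Dom_rins x h.2⟩
        · simp only [rins, hc, if_false]
          exact ⟨h.1, ih h.2 hb⟩

theorem tins_headD (L : List (List ℕ)) (b : ℕ) :
    (tins L b).headD [] = (rins (L.headD []) b).1 := by
  cases L with
  | nil => simp [tins, rins]
  | cons R L => simp only [tins]; split <;> simp

theorem Tab_tins {L : List (List ℕ)} (x : ℕ) (h : Tab L) : Tab (tins L x) := by
  induction L generalizing x with
  | nil => exact ⟨by simp, Dom_nil _, trivial⟩
  | cons R L ih =>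
    rcases rins_bump R x with h' | ⟨b, h', _, _⟩
    · simp only [tins, h']
      exact ⟨rins_sorted x h.1, Dom_rins x h.2.1, h.2.2⟩
    · simp only [tins, h']
      refine ⟨rins_sorted x h.1, ?_, ih b h.2.2⟩
      rw [tins_headD]
      exact Dom_rins_rins h.2.1 h'

theorem rins_ne (r : List ℕ) (x : ℕ) : (rins r x).1 ≠ [] := by
  cases r with
  | nil => simp [rins]
  | cons a r => by_cases hx : x < a <;> simp [rins, hx]

theorem tins_ne {L : List (List ℕ)} (x : ℕ) (h : ∀ R ∈ L, R ≠ []) :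
    ∀ R ∈ tins L x, R ≠ [] := by
  induction L generalizing x with
  | nil => simp [tins]
  | cons R L ih =>
    have h2 : ∀ R ∈ L, R ≠ [] := fun S hS => h S (by simp [hS])
    rcases rins_bump R x with h' | ⟨b, h', _, _⟩
    · simp only [tins, h', List.mem_cons, forall_eq_or_imp]
      exact ⟨rins_ne _ _, h2⟩
    · simp only [tins, h', List.mem_cons, forall_eq_or_imp]
      exact ⟨rins_ne _ _, ih b h2⟩

theorem tins_mem {P : ℕ → Prop} {L : List (List ℕ)} {x : ℕ} (hx : P x)
    (h : ∀ R ∈ L, ∀ a ∈ R, P a) : ∀ R ∈ tins L x, ∀ a ∈ R, P a := by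
  induction L generalizing x with
  | nil => simpa [tins] using hx
  | cons R L ih =>
    have h2 : ∀ R ∈ L, ∀ a ∈ R, P a := fun S hS => h S (by simp [hS])
    have h1 : ∀ a ∈ (rins R x).1, P a := by
      intro a ha
      rcases rins_mem ha with h3 | h3
      · exact h R (by simp) a h3
      · exact h3 ▸ hx
    rcases rins_bump R x with h' | ⟨b, h', _, hb⟩
    · simp only [tins, h', List.mem_cons, forall_eq_or_imp]
      exact ⟨h1, h2⟩
    · simp only [tins, h', List.mem_cons, forall_eq_or_imp]
      exact ⟨h1, ih (h R (by simp) b hb) h2⟩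

theorem exists_tab {P : ℕ → Prop} (v : List ℕ) (hv : ∀ a ∈ v, P a) :
    ∃ L, Tab L ∧ (∀ R ∈ L, R ≠ []) ∧ (∀ R ∈ L, ∀ a ∈ R, P a) ∧ KnuthEquiv v (wordOf L) := by
  induction v using List.reverseRecOn with
  | nil => exact ⟨[], trivial, by simp, by simp, KE_refl _⟩
  | append_singleton v x ih =>
    obtain ⟨L, h1, h2, h3, h4⟩ := ih (fun a ha => hv a (by simp [ha]))
    exact ⟨tins L x, Tab_tins x h1, tins_ne x h2, tins_mem (hv x (by simp)) h3,
      KE_trans (KE_right [x] h4) (KE_tins x h1)⟩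

theorem Dom_iff {r s : List ℕ} :
    Dom r s ↔ s.length ≤ r.length ∧ ∀ c, c < s.length → r.getD c 0 < s.getD c 0 := by
  induction r generalizing s with
  | nil =>
    cases s with
    | nil => simp [Dom]
    | cons b s => simp [Dom]
  | cons a r ih =>
    cases s with
    | nil => simp [Dom]
    | cons b s =>
      simp only [Dom, ih, List.length_cons]
      constructor
      · rintro ⟨h1, h2, h3⟩
        refine ⟨by omega, fun c hc => ?_⟩
        cases c with
        | zero => simpa using h1
        | succ c => simpa using h3 c (by omega)
      · rintro ⟨h1, h2⟩
        refine ⟨by simpa using h2 0 (by omega), by omega, fun c hc => ?_⟩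
        simpa using h2 (c + 1) (by omega)

theorem Tab_iff {L : List (List ℕ)} :
    Tab L ↔ (∀ k, (L.getD k []).Pairwise (· ≤ ·)) ∧
      ∀ k, Dom (L.getD k []) (L.getD (k + 1) []) := by
  induction L with
  | nil => simp [Tab, Dom]
  | cons R L ih =>
    have h0 : L.headD [] = L.getD 0 [] := by cases L <;> simp
    simp only [Tab, ih, h0]
    constructor
    · rintro ⟨h1, h2, h3, h4⟩
      refine ⟨fun k => ?_, fun k => ?_⟩
      · cases k with
        | zero => simpa using h1
        | succ k => simpa using h3 k
      · cases k with
        | zero => simpa using h2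
        | succ k => simpa using h4 k
    · rintro ⟨h1, h2⟩
      exact ⟨by simpa using h1 0, by simpa using h2 0, fun k => by simpa using h1 (k + 1),
        fun k => by simpa using h2 (k + 1)⟩

theorem Tab_length {n m : ℕ} {L : List (List ℕ)} (h : Tab L) (hne : ∀ R ∈ L, R ≠ [])
    (hle : ∀ R ∈ L, ∀ a ∈ R, a ≤ n) (hm : ∀ a, (L.getD 0 []).getD 0 a = a ∨ m < (L.getD 0 []).getD 0 a)
    (hmn : m ≤ n) : L.length + m ≤ n := by
  induction L generalizing m with
  | nil => simpa using hmn
  | cons R L ih =>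
    obtain ⟨a, r, rfl⟩ := List.exists_cons_of_ne_nil (hne R (by simp))
    have ha : m < a := by
      have := hm (a + 1)
      simpa using this
    have han := hle (a :: r) (by simp) a (by simp)
    have := ih (m := m + 1) h.2.2 (fun S hS => hne S (by simp [hS]))
      (fun S hS => hle S (by simp [hS])) ?_ (by omega)
    · simp only [List.length_cons]; omega
    · intro b
      have hd := h.2.1
      cases L with
      | nil => simp
      | cons S L =>
        cases S with
        | nil => simp
        | cons c s =>
          right
          have : a < c := hd.1
          simp
          omega

/-! ### Relation with the type `SSYT` -/

/-- The rows of a tableau. -/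
def rowsOf {n : ℕ} {μ : ℕ → ℕ} (Y : SSYT n μ) : List (List ℕ) :=
  (List.range n).map fun i => (List.range (μ (i + 1))).map fun c => Y.entry (i + 1) c

theorem readingWord_eq {n : ℕ} {μ : ℕ → ℕ} (Y : SSYT n μ) :
    readingWord n μ Y = wordOf (rowsOf Y) := by
  simp [readingWord, wordOf, rowsOf, List.flatMap, List.map_reverse, Function.comp_def]

theorem rowsOf_getD {n : ℕ} {μ : ℕ → ℕ} (Y : SSYT n μ) {k : ℕ} (hk : k < n) :
    (rowsOf Y).getD k [] = (List.range (μ (k + 1))).map fun c => Y.entry (k + 1) c := by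
  simp [rowsOf, List.getD_eq_getElem?_getD, hk]

theorem rowsOf_getD_ge {n : ℕ} {μ : ℕ → ℕ} (Y : SSYT n μ) {k : ℕ} (hk : n ≤ k) :
    (rowsOf Y).getD k [] = [] := by
  simp [rowsOf, List.getD_eq_getElem?_getD, hk]

theorem Tab_rowsOf {n : ℕ} {μ : ℕ → ℕ} (Y : SSYT n μ) (hμ : IsPartition n μ) :
    Tab (rowsOf Y) := by
  rw [Tab_iff]
  refine ⟨fun k => ?_, fun k => ?_⟩
  · by_cases hk : k < n
    · rw [rowsOf_getD Y hk, List.pairwise_iff_getElem]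
      intro i j hi hj hij
      simp only [List.length_map, List.length_range] at hi hj
      simpa using Y.row_weak (k + 1) i j (by omega) (by omega) hij.le hj
    · rw [rowsOf_getD_ge Y (by omega)]
      simp
  · by_cases hk : k + 1 < n
    · rw [rowsOf_getD Y hk, rowsOf_getD Y (by omega : k < n), Dom_iff]
      have hle := hμ.1 (k + 1) (by omega) hk
      refine ⟨by simpa using hle, fun c hc => ?_⟩
      simp only [List.length_map, List.length_range] at hc
      have hc' : c < μ (k + 1) := by omega
      simpa [List.getD_eq_getElem?_getD, hc, hc'] using
        Y.col_strict (k + 1) (k + 1 + 1) c (by omega) (by omega) (by omega) hc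
    · rw [rowsOf_getD_ge Y (by omega : n ≤ k + 1)]
      exact Dom_nil _

theorem exists_SSYT {n : ℕ} {L : List (List ℕ)} (h : Tab L) (hL : L.length ≤ n)
    (hP : ∀ R ∈ L, ∀ a ∈ R, 1 ≤ a ∧ a ≤ n) :
    ∃ (μ : ℕ → ℕ) (Y : SSYT n μ), IsPartition n μ ∧ readingWord n μ Y = wordOf L := by
  rw [Tab_iff] at h
  obtain ⟨hs, hd⟩ := h
  have hmem : ∀ k c, c < (L.getD k []).length →
      1 ≤ (L.getD k []).getD c 0 ∧ (L.getD k []).getD c 0 ≤ n := by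
    intro k c hc
    by_cases hk : k < L.length
    · refine hP (L.getD k []) ?_ _ ?_
      · rw [List.getD_eq_getElem _ _ hk]
        exact List.getElem_mem _
      · rw [List.getD_eq_getElem _ _ hc]
        exact List.getElem_mem _
    · rw [List.getD_eq_default _ _ (by omega)] at hc
      simp at hc
  have hlen : ∀ k, (L.getD (k + 1) []).length ≤ (L.getD k []).length :=
    fun k => (Dom_iff.1 (hd k)).1
  have hcol : ∀ d k c, c < (L.getD (k + d + 1) []).length →
      (L.getD k []).getD c 0 < (L.getD (k + d + 1) []).getD c 0 := by
    intro d
    induction d with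
    | zero => exact fun k c hc => (Dom_iff.1 (hd k)).2 c hc
    | succ d ih =>
      intro k c hc
      have h1 := (Dom_iff.1 (hd (k + d + 1))).2 c hc
      have h2 := ih k c (lt_of_lt_of_le hc (hlen _))
      exact h2.trans h1
  let μ : ℕ → ℕ := fun j => if j = 0 then 0 else (L.getD (j - 1) []).length
  let Y : SSYT n μ :=
    { entry := fun j c => if j = 0 then 0 else (L.getD (j - 1) []).getD c 0
      entry_mem := by
        intro j c h1 h2 h3
        have hj : j ≠ 0 := by omega
        simp only [μ, hj, if_false] at h3 ⊢
        exact hmem _ _ h3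
      row_weak := by
        intro j c d h1 h2 h3 h4
        have hj : j ≠ 0 := by omega
        simp only [μ, hj, if_false] at h4 ⊢
        rcases eq_or_lt_of_le h3 with h5 | h5
        · rw [h5]
        · rw [List.getD_eq_getElem _ _ h4, List.getD_eq_getElem _ _ (h5.trans h4)]
          exact List.pairwise_iff_getElem.1 (hs (j - 1)) _ _ _ _ h5
      col_strict := by
        intro i j c h1 h2 h3 h4
        have hi : i ≠ 0 := by omega
        have hj : j ≠ 0 := by omega
        obtain ⟨d, rfl⟩ := Nat.exists_eq_add_of_lt h2
        simp only [μ, hi, hj, if_false] at h4 ⊢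
        have he : i + d + 1 - 1 = i - 1 + d + 1 := by omega
        rw [he] at h4 ⊢
        exact hcol d (i - 1) c h4
      outside := by
        intro j c h1
        by_cases hj : j = 0
        · simp [hj]
        · simp only [μ, hj, if_false, false_or] at h1 ⊢
          rcases h1 with h1 | h1
          · rw [List.getD_eq_default L _ (by omega)]
            simp
          · exact List.getD_eq_default _ _ h1 }
  refine ⟨μ, Y, ⟨fun j h1 h2 => ?_, fun j hj => ?_⟩, ?_⟩
  · have hj : j ≠ 0 := by omega
    obtain ⟨k, rfl⟩ := Nat.exists_eq_succ_of_ne_zero hj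
    simpa [μ] using hlen k
  · by_cases h0 : j = 0
    · simp [μ, h0]
    · simp only [μ, h0, if_false]
      rw [List.getD_eq_default L _ (by omega)]
      rfl
  · rw [readingWord_eq]
    have hrows : rowsOf Y = L ++ List.replicate (n - L.length) [] := by
      apply List.ext_getElem
      · simp [rowsOf]; omega
      · intro i h1 h2
        have hi : i < n := by simpa [rowsOf] using h1
        have e1 : (rowsOf Y)[i] = L.getD i [] := by
          rw [← List.getD_eq_getElem _ [] h1, rowsOf_getD Y hi]
          apply List.ext_getElem
          · simp [μ]
          · intro c h3 h4
            simp [Y, List.getD_eq_getElem?_getD] at h4 ⊢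
            simp [h4]
        rw [e1, List.getElem_append]
        split
        · rw [List.getD_eq_getElem]
        · rw [List.getD_eq_default _ _ (by omega)]
          simp
    rw [hrows]
    simp [wordOf]

theorem SSYT_unique {n : ℕ} {μ₁ μ₂ : ℕ → ℕ} (Y₁ : SSYT n μ₁) (Y₂ : SSYT n μ₂)
    (h₁ : IsPartition n μ₁) (h₂ : IsPartition n μ₂)
    (h : KnuthEquiv (readingWord n μ₁ Y₁) (readingWord n μ₂ Y₂)) :
    μ₁ = μ₂ ∧ Y₁.entry = Y₂.entry := by
  rw [readingWord_eq, readingWord_eq] at h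
  have key : ∀ k, k < n →
      ((List.range (μ₁ (k + 1))).map fun c => Y₁.entry (k + 1) c) =
        (List.range (μ₂ (k + 1))).map fun c => Y₂.entry (k + 1) c := by
    intro k hk
    have := rowP_equiv k h
    rwa [rowP_wordOf (Tab_rowsOf Y₁ h₁) k (by simpa [rowsOf] using hk),
      rowP_wordOf (Tab_rowsOf Y₂ h₂) k (by simpa [rowsOf] using hk),
      rowsOf_getD Y₁ hk, rowsOf_getD Y₂ hk] at this
  have hμ : μ₁ = μ₂ := by
    funext j
    by_cases hj : j = 0 ∨ n < j
    · rw [h₁.2 j hj, h₂.2 j hj]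
    · obtain ⟨k, rfl⟩ := Nat.exists_eq_succ_of_ne_zero (n := j) (by omega)
      simpa using congrArg List.length (key k (by omega))
  subst hμ
  refine ⟨rfl, ?_⟩
  funext j c
  by_cases hj : j = 0 ∨ n < j ∨ μ₁ j ≤ c
  · rw [Y₁.outside j c hj, Y₂.outside j c hj]
  · obtain ⟨k, rfl⟩ := Nat.exists_eq_succ_of_ne_zero (n := j) (by omega)
    have h3 := key k (by omega)
    rw [List.map_inj_left] at h3
    exact h3 c (by simp only [List.mem_range, Nat.succ_eq_add_one] at hj ⊢; omega)

/-- Distinct semistandard Young tableaux have Knuth-inequivalent reading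
words, and every word with letters in `{1,…,n}` is Knuth equivalent to the reading word of
exactly one semistandard Young tableau. -/
theorem knuth_reading_words (n : ℕ) (hn : 0 < n) :
    (∀ (μ₁ μ₂ : ℕ → ℕ) (Y₁ : SSYT n μ₁) (Y₂ : SSYT n μ₂),
        IsPartition n μ₁ → IsPartition n μ₂ →
        KnuthEquiv (readingWord n μ₁ Y₁) (readingWord n μ₂ Y₂) →
        μ₁ = μ₂ ∧ Y₁.entry = Y₂.entry) ∧
    (∀ v : List ℕ, (∀ a ∈ v, 1 ≤ a ∧ a ≤ n) →
        ∃ (μ : ℕ → ℕ) (Y : SSYT n μ), IsPartition n μ ∧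
          KnuthEquiv v (readingWord n μ Y) ∧
          ∀ (μ' : ℕ → ℕ) (Y' : SSYT n μ'), IsPartition n μ' →
            KnuthEquiv v (readingWord n μ' Y') → μ' = μ ∧ Y'.entry = Y.entry) := by
  refine ⟨fun μ₁ μ₂ Y₁ Y₂ h₁ h₂ h => SSYT_unique Y₁ Y₂ h₁ h₂ h, fun v hv => ?_⟩
  obtain ⟨L, h1, h2, h3, h4⟩ := exists_tab (P := fun a => 1 ≤ a ∧ a ≤ n) v hv
  have hlen : L.length + 0 ≤ n := by
    refine Tab_length h1 h2 (fun R hR a ha => (h3 R hR a ha).2) ?_ (by omega)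
    intro b
    cases L with
    | nil => simp
    | cons R L =>
      cases R with
      | nil => simp
      | cons a r =>
        right
        exact (h3 (a :: r) (by simp) a (by simp)).1
  obtain ⟨μ, Y, hμ, hY⟩ := exists_SSYT h1 hlen h3
  rw [← hY] at h4
  exact ⟨μ, Y, hμ, h4, fun μ' Y' hμ' h' =>
    SSYT_unique Y' Y hμ' hμ (KE_trans (KE_symm h') h4)⟩

end RCGraphs
end
end
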